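/- Suppose the weight function w depends only on time and the two opinion values, i.e. w(t,α,β,a,b) = w̃(t,a,b) for a function w̃ : [0,∞) × ℝ × ℝ → ℝ that is nonnegative, bounded by W, symmetric in its last two arguments (w̃(t,a,b) = w̃(t,b,a)), and Lipschitz continuous in the sense that |w̃(t,x,y) − w̃(t,x,z)| ≤ L·|y − z| for all t, x, y, z and some constant L. Then for any solution x of the opinion dynamics, the limit lim_{t→∞} x_t(α) exists for Lebesgue-almost every α ∈ [0,1]. -/

import Mathlib

open MeasureTheory Filter Set Topology

/-- The interaction field at time `t` for agent `α`:
`∫_0^1 w(t,α,β,x_t(α),x_t(β)) · (x_t(β) − x_t(α)) dβ`. -/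
noncomputable def interactionField (w : ℝ → ℝ → ℝ → ℝ → ℝ → ℝ) (x : ℝ → ℝ → ℝ)
    (t α : ℝ) : ℝ :=
  ∫ β in (0:ℝ)..1, w t α β (x t α) (x t β) * (x t β - x t α)

/-- `f` is absolutely continuous on the compact interval `[a,b]`. -/
def AbsolutelyContinuousOn (f : ℝ → ℝ) (a b : ℝ) : Prop :=
  ∀ ε > 0, ∃ δ > 0, ∀ n : ℕ, ∀ c d : Fin n → ℝ,
    (∀ i, a ≤ c i ∧ c i ≤ d i ∧ d i ≤ b) →
    (Pairwise fun i j => Set.Ioo (c i) (d i) ∩ Set.Ioo (c j) (d j) = ∅) →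
    (∑ i, (d i - c i)) < δ → (∑ i, |f (d i) - f (c i)|) < ε

/-- `w` is an admissible weight function: jointly Borel measurable, nonnegative and
bounded by `W` on the domain `[0,∞) × [0,1] × [0,1] × ℝ × ℝ`. -/
structure IsWeight (W : ℝ) (w : ℝ → ℝ → ℝ → ℝ → ℝ → ℝ) : Prop where
  measurable : Measurable fun p : ℝ × ℝ × ℝ × ℝ × ℝ =>
    w p.1 p.2.1 p.2.2.1 p.2.2.2.1 p.2.2.2.2
  nonneg : ∀ t, 0 ≤ t → ∀ α ∈ Icc (0:ℝ) 1, ∀ β ∈ Icc (0:ℝ) 1, ∀ a b : ℝ,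
    0 ≤ w t α β a b
  le_bound : ∀ t, 0 ≤ t → ∀ α ∈ Icc (0:ℝ) 1, ∀ β ∈ Icc (0:ℝ) 1, ∀ a b : ℝ,
    w t α β a b ≤ W

/-- `x` is a solution of the opinion dynamics with weight function `w`:
measurable in the agent, absolutely continuous in time on compact intervals,
with initial opinions in `[0,1]`, locally bounded, and for each agent satisfying
the ODE `(d/dt) x_t(α) = ∫_0^1 w(t,α,β,x_t(α),x_t(β))·(x_t(β) − x_t(α)) dβ`
for almost every `t ≥ 0`. -/
structure IsSolution (w : ℝ → ℝ → ℝ → ℝ → ℝ → ℝ) (x : ℝ → ℝ → ℝ) : Prop where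
  meas : ∀ t, 0 ≤ t → Measurable (x t)
  absCont : ∀ α ∈ Icc (0:ℝ) 1, ∀ T, 0 ≤ T → AbsolutelyContinuousOn (fun t => x t α) 0 T
  init_mem : ∀ α ∈ Icc (0:ℝ) 1, x 0 α ∈ Icc (0:ℝ) 1
  locBdd : ∀ T, 0 ≤ T → ∃ M : ℝ, ∀ α ∈ Icc (0:ℝ) 1, ∀ t ∈ Icc (0:ℝ) T, |x t α| ≤ M
  ode : ∀ α ∈ Icc (0:ℝ) 1, ∀ᵐ t ∂(volume.restrict (Ici (0:ℝ))),
    HasDerivAt (fun s => x s α) (interactionField w x t α) t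

/-- The weight function is symmetric. -/
def SymmetricWeight (w : ℝ → ℝ → ℝ → ℝ → ℝ → ℝ) : Prop :=
  ∀ t α β a b, w t α β a b = w t β α b a

/-- `w ∈ Γ(r,Δ)`: the weight is at least `Δ` whenever the two opinions are within `r`. -/
def InGamma (r Δ : ℝ) (w : ℝ → ℝ → ℝ → ℝ → ℝ → ℝ) : Prop :=
  ∀ t, 0 ≤ t → ∀ α ∈ Icc (0:ℝ) 1, ∀ β ∈ Icc (0:ℝ) 1, ∀ a b : ℝ,
    |a - b| ≤ r → Δ ≤ w t α β a b

/-- The opinion distribution `μ_t`: pushforward of Lebesgue measure on `[0,1]` by `x_t`. -/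
noncomputable def opinionMeasure (x : ℝ → ℝ → ℝ) (t : ℝ) : Measure ℝ :=
  (volume.restrict (Icc (0:ℝ) 1)).map (x t)

/-- The order of the opinions is preserved: if agent `β`'s opinion is strictly above
agent `α`'s at some time, it is strictly above at every time. -/
def OrderPreserved (x : ℝ → ℝ → ℝ) : Prop :=
  ∀ α ∈ Icc (0:ℝ) 1, ∀ β ∈ Icc (0:ℝ) 1, ∀ s, 0 ≤ s → ∀ t, 0 ≤ t →
    x t α < x t β → x s α < x s β

theorem AbsolutelyContinuousOn.absolutelyContinuousOnInterval {f : ℝ → ℝ} {a b : ℝ}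
    (hab : a ≤ b) (hf : AbsolutelyContinuousOn f a b) :
    AbsolutelyContinuousOnInterval f a b := by
  rw [absolutelyContinuousOnInterval_iff]
  intro ε hε
  obtain ⟨δ, hδ, H⟩ := hf ε hε
  refine ⟨δ, hδ, ?_⟩
  rintro ⟨n, I⟩ ⟨hI, hdisj⟩ hlen
  simp only [uIcc_of_le hab, Finset.mem_range] at hI hlen ⊢
  have key := H n (fun i => min (I i).1 (I i).2) (fun i => max (I i).1 (I i).2) ?_ ?_ ?_
  · rw [← Fin.sum_univ_eq_sum_range (fun i => dist (f (I i).1) (f (I i).2))]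
    refine lt_of_eq_of_lt (Finset.sum_congr rfl fun i _ => ?_) key
    rcases le_total (I i).1 (I i).2 with h | h
    · simp [h, Real.dist_eq, abs_sub_comm]
    · simp [h, Real.dist_eq]
  · intro i
    obtain ⟨h1, h2⟩ := hI i i.2
    exact ⟨le_min h1.1 h2.1, min_le_max, max_le h1.2 h2.2⟩
  · intro i j hij
    have := hdisj (by simp) (by simp) (fun h => hij (Fin.ext h) : (i : ℕ) ≠ j)
    exact (this.mono Ioo_subset_Ioc_self Ioo_subset_Ioc_self).inter_eq
  · rw [← Fin.sum_univ_eq_sum_range (fun i => dist (I i).1 (I i).2)] at hlen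
    refine lt_of_eq_of_lt (Finset.sum_congr rfl fun i _ => ?_) hlen
    rw [max_sub_min_eq_abs', Real.dist_eq]

/-- An absolutely continuous function with nonpositive derivative almost everywhere decreases. -/
theorem AbsolutelyContinuousOnInterval.le_of_ae_deriv_nonpos {f : ℝ → ℝ} {a b : ℝ}
    (hab : a ≤ b) (hf : AbsolutelyContinuousOnInterval f a b)
    (hd : ∀ᵐ t, t ∈ Ioc a b → ∃ d ≤ 0, HasDerivAt f d t) : f b ≤ f a := by
  have h : ∫ t in a..b, deriv f t ≤ 0 := by
    rw [intervalIntegral.integral_of_le hab]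
    apply integral_nonpos_of_ae
    rw [EventuallyLE, ae_restrict_iff' measurableSet_Ioc]
    filter_upwards [hd] with t ht hmem
    obtain ⟨d, hd0, hd⟩ := ht hmem
    simpa [hd.deriv] using hd0
  rw [hf.integral_deriv_eq_sub] at h
  linarith

/-- A one-dimensional uniqueness statement: if `|z'| ≤ K |z|`, then `z` cannot become positive. -/
theorem nonpos_of_abs_deriv_le {z : ℝ → ℝ} {K T : ℝ} (hT : 0 ≤ T)
    (hz : AbsolutelyContinuousOnInterval z 0 T)
    (hd : ∀ᵐ t, t ∈ Ioc 0 T → ∃ d, HasDerivAt z d t ∧ |d| ≤ K * |z t|) (h0 : z 0 ≤ 0) :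
    z T ≤ 0 := by
  by_contra! hpos
  have hc : ContinuousOn z (Icc 0 T) := by simpa [uIcc_of_le hT] using hz.continuousOn
  obtain ⟨s, hs, hzs⟩ := intermediate_value_Icc hT hc ⟨h0, hpos.le⟩
  have hzs' : AbsolutelyContinuousOnInterval z s T :=
    hz.mono (by rw [uIcc_of_le hs.2, uIcc_of_le hT]; exact Icc_subset_Icc_left hs.1)
  have he : AbsolutelyContinuousOnInterval (fun t => Real.exp (-(2 * K) * t)) s T :=
    ContDiffOn.absolutelyContinuousOnInterval (by fun_prop)
  have key := (he.fun_mul (hzs'.fun_mul hzs')).le_of_ae_deriv_nonpos hs.2 ?_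
  · rw [hzs] at key
    have : 0 < Real.exp (-(2 * K) * T) * (z T * z T) := by positivity
    linarith
  · filter_upwards [hd] with t ht hmem
    obtain ⟨d, hd, hdK⟩ := ht ⟨hs.1.trans_lt hmem.1, hmem.2⟩
    have hexp : HasDerivAt (fun t => Real.exp (-(2 * K) * t))
        (Real.exp (-(2 * K) * t) * (-(2 * K) * 1)) t :=
      ((hasDerivAt_id t).const_mul (-(2 * K))).exp
    refine ⟨_, ?_, hexp.mul (hd.mul hd)⟩
    have h1 : z t * d ≤ K * (z t * z t) := by
      calc z t * d ≤ |z t| * |d| := by rw [← abs_mul]; exact le_abs_self _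
        _ ≤ |z t| * (K * |z t|) := by gcongr
        _ = K * (z t * z t) := by rw [← abs_mul_abs_self (z t)]; ring
    have h2 := mul_le_mul_of_nonneg_left h1 (Real.exp_pos (-(2 * K) * t)).le
    nlinarith

/-- A maximum principle for families of absolutely continuous functions. -/
theorem nonpos_of_deriv_le_bound_sub {Ω : Type*} {y : ℝ → Ω → ℝ} {W T : ℝ} (hT : 0 ≤ T)
    (hy : ∀ α, ∀ t ∈ Icc 0 T, AbsolutelyContinuousOnInterval (fun s => y s α) 0 t)
    (h0 : ∀ α, y 0 α ≤ 0) (hb : ∃ M, ∀ α, ∀ t ∈ Icc 0 T, y t α ≤ M)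
    (hd : ∀ α, ∀ᵐ t, t ∈ Ioc 0 T → ∃ d, HasDerivAt (fun s => y s α) d t ∧
      ∀ B, 0 ≤ B → (∀ β, y t β ≤ B) → d ≤ W * (B - y t α)) (α : Ω) :
    y T α ≤ 0 := by
  obtain ⟨M, hM⟩ := hb
  have iter : ∀ n : ℕ, ∀ α, ∀ t ∈ Icc 0 T,
      y t α ≤ (|M| * Real.exp (2 * |W| * T)) * (1 / 3) ^ n * Real.exp (2 * W * t) := by
    intro n
    induction n with
    | zero =>
      intro α t ht
      have h1 : 0 ≤ 2 * |W| * T + 2 * W * t := by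
        nlinarith [neg_abs_le W, abs_nonneg W, ht.1, ht.2,
          mul_le_mul_of_nonneg_left ht.2 (abs_nonneg W),
          mul_le_mul_of_nonneg_right (neg_abs_le W) ht.1]
      calc y t α ≤ |M| * 1 := by rw [mul_one]; exact (hM α t ht).trans (le_abs_self M)
        _ ≤ |M| * Real.exp (2 * |W| * T + 2 * W * t) := by
          gcongr; exact Real.one_le_exp h1
        _ = _ := by rw [Real.exp_add]; ring
    | succ n ih =>
      intro α t ht
      set S := (|M| * Real.exp (2 * |W| * T)) * (1 / 3) ^ n with hS
      have hS0 : 0 ≤ S := by positivity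
      have he : AbsolutelyContinuousOnInterval (fun t => Real.exp (W * t)) 0 t :=
        ContDiffOn.absolutelyContinuousOnInterval (by fun_prop)
      have he3 : AbsolutelyContinuousOnInterval (fun t => S / 3 * Real.exp (3 * W * t)) 0 t :=
        ContDiffOn.absolutelyContinuousOnInterval (by fun_prop)
      have key := ((he.fun_mul (hy α t ht)).fun_sub he3).le_of_ae_deriv_nonpos ht.1 ?_
      · have h3 : Real.exp (3 * W * t) = Real.exp (W * t) * Real.exp (2 * W * t) := by
          rw [← Real.exp_add]; ring_nf
        simp only [mul_zero, Real.exp_zero, one_mul, mul_one] at key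
        rw [h3] at key
        have hp := Real.exp_pos (W * t)
        have : Real.exp (W * t) * y t α ≤
            Real.exp (W * t) * (S / 3 * Real.exp (2 * W * t)) := by
          nlinarith [h0 α]
        have := le_of_mul_le_mul_left this hp
        exact this.trans_eq (by rw [hS]; ring)
      · filter_upwards [hd α] with s hs hmem
        have hsT : s ∈ Icc 0 T := ⟨hmem.1.le, hmem.2.trans ht.2⟩
        obtain ⟨d, hd, hB⟩ := hs ⟨hmem.1, hsT.2⟩
        have hB := hB (S * Real.exp (2 * W * s)) (by positivity) (fun β => ih β s hsT)
        have hexp : ∀ c : ℝ, HasDerivAt (fun t => Real.exp (c * t))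
            (Real.exp (c * s) * (c * 1)) s := fun c => ((hasDerivAt_id s).const_mul c).exp
        refine ⟨_, ?_, ((hexp W).mul hd).sub ((hexp (3 * W)).const_mul (S / 3))⟩
        have h3 : Real.exp (3 * W * s) = Real.exp (W * s) * Real.exp (2 * W * s) := by
          rw [← Real.exp_add]; ring_nf
        rw [h3]
        have := mul_le_mul_of_nonneg_left hB (Real.exp_pos (W * s)).le
        nlinarith
  have hlim : Tendsto (fun n : ℕ => (|M| * Real.exp (2 * |W| * T)) * (1 / 3 : ℝ) ^ n *
      Real.exp (2 * W * T)) atTop (𝓝 0) := by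
    have := ((tendsto_pow_atTop_nhds_zero_of_lt_one (r := (1 / 3 : ℝ)) (by norm_num)
      (by norm_num)).const_mul (|M| * Real.exp (2 * |W| * T))).mul_const (Real.exp (2 * W * T))
    simpa using this
  exact ge_of_tendsto' hlim fun n => iter n α T ⟨hT, le_rfl⟩

/-- The flux of an antisymmetric bounded kernel out of a set is nonpositive, as soon as the kernel
is nonpositive across the boundary of that set. -/
theorem setIntegral_integral_nonpos_of_antisymm {Ω : Type*} [MeasurableSpace Ω] {ν : Measure Ω}
    [IsFiniteMeasure ν] {k : Ω → Ω → ℝ} {C : ℝ} (hk : Measurable (Function.uncurry k))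
    (hC : ∀ α β, |k α β| ≤ C) (hanti : ∀ α β, k α β = -k β α) {A : Set Ω}
    (hA : MeasurableSet A) (hneg : ∀ α ∈ A, ∀ β ∉ A, k α β ≤ 0) :
    ∫ α in A, ∫ β, k α β ∂ν ∂ν ≤ 0 := by
  have hint : ∀ B : Set Ω, Integrable (Function.uncurry k) ((ν.restrict A).prod (ν.restrict B)) :=
    fun B => Integrable.of_bound hk.aestronglyMeasurable C (ae_of_all _ fun p => hC p.1 p.2)
  have hsec : ∀ α, Integrable (k α) ν := fun α =>
    Integrable.of_bound (hk.comp measurable_prodMk_left).aestronglyMeasurable C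
      (ae_of_all _ fun β => hC α β)
  have hsplit : ∀ α, ∫ β, k α β ∂ν = ∫ β in A, k α β ∂ν + ∫ β in Aᶜ, k α β ∂ν :=
    fun α => (integral_add_compl hA (hsec α)).symm
  simp_rw [hsplit]
  have hadd := integral_add (hint A).integral_prod_left (hint Aᶜ).integral_prod_left
  simp only [Function.uncurry_apply_pair] at hadd
  rw [hadd]
  have h1 : ∫ α in A, ∫ β in A, k α β ∂ν ∂ν = 0 := by
    have hswap := integral_integral_swap (hint A)
    have : ∫ β in A, ∫ α in A, k α β ∂ν ∂ν = -∫ β in A, ∫ α in A, k β α ∂ν ∂ν := by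
      simp_rw [← integral_neg]
      congr! 3 with β α
      ext α
      exact hanti α β
    linarith
  have h2 : ∫ α in A, ∫ β in Aᶜ, k α β ∂ν ∂ν ≤ 0 :=
    setIntegral_nonpos hA fun α hα => setIntegral_nonpos hA.compl fun β hβ => hneg α hα β hβ
  linarith

section OrderPreserving

variable {Ω : Type*} [MeasurableSpace Ω] {ν : Measure Ω} [IsFiniteMeasure ν] {X : ℝ → Ω → ℝ}

theorem measure_preimage_Icc_eq_zero_of_oscillation (hmeas : ∀ t, Measurable (X t))
    (hbd : ∀ t, 0 ≤ t → ∀ α, X t α ∈ Icc (0 : ℝ) 1)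
    (hmono : ∀ α β, X 0 α ≤ X 0 β → ∀ t, 0 ≤ t → X t α ≤ X t β)
    (hconv : ∀ U : Set ℝ, IsUpperSet U → MeasurableSet U →
      ∃ l, Tendsto (fun t => ∫ α in X 0 ⁻¹' U, X t α ∂ν) atTop (𝓝 l))
    {q r : ℝ} (hqr : q < r) {α β : Ω} (hαβ : X 0 α ≤ X 0 β)
    (hα : ∃ᶠ t in atTop, r < X t α) (hβ : ∃ᶠ t in atTop, X t β < q) :
    ν (X 0 ⁻¹' Icc (X 0 α) (X 0 β)) = 0 := by
  set J := X 0 ⁻¹' Icc (X 0 α) (X 0 β) with hJ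
  have hJm : MeasurableSet J := hmeas 0 measurableSet_Icc
  have hint : ∀ t, 0 ≤ t → Integrable (X t) ν := fun t ht =>
    Integrable.of_bound (hmeas t).aestronglyMeasurable 1 (ae_of_all _ fun ω => by
      rw [Real.norm_eq_abs, abs_le]; constructor <;> linarith [(hbd t ht ω).1, (hbd t ht ω).2])
  obtain ⟨l₁, hl₁⟩ := hconv (Ici (X 0 α)) (isUpperSet_Ici _) measurableSet_Ici
  obtain ⟨l₂, hl₂⟩ := hconv (Ioi (X 0 β)) (isUpperSet_Ioi _) measurableSet_Ioi
  have hlim : Tendsto (fun t => ∫ ω in J, X t ω ∂ν) atTop (𝓝 (l₁ - l₂)) := by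
    refine (hl₁.sub hl₂).congr' ?_
    filter_upwards [eventually_ge_atTop 0] with t ht
    have hU : X 0 ⁻¹' Ici (X 0 α) = J ∪ X 0 ⁻¹' Ioi (X 0 β) := by
      rw [hJ, ← preimage_union, Icc_union_Ioi_eq_Ici hαβ]
    have hdisj : Disjoint J (X 0 ⁻¹' Ioi (X 0 β)) :=
      Disjoint.preimage _ (Set.disjoint_left.2 fun a ha hb => not_lt.2 ha.2 hb)
    rw [hU, setIntegral_union hdisj (hmeas 0 measurableSet_Ioi) (hint t ht).integrableOn
      (hint t ht).integrableOn]
    ring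
  have hlow : ∀ t, 0 ≤ t → ν.real J * X t α ≤ ∫ ω in J, X t ω ∂ν := fun t ht => by
    have := setIntegral_mono_on (integrableOn_const (measure_ne_top ν J))
      (hint t ht).integrableOn hJm fun ω (hω : ω ∈ J) => hmono α ω hω.1 t ht
    simpa using this
  have hup : ∀ t, 0 ≤ t → ∫ ω in J, X t ω ∂ν ≤ ν.real J * X t β := fun t ht => by
    have := setIntegral_mono_on (hint t ht).integrableOn
      (integrableOn_const (measure_ne_top ν J)) hJm
      fun ω (hω : ω ∈ J) => hmono ω β hω.2 t ht
    simpa using this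
  have hm : 0 ≤ ν.real J := measureReal_nonneg
  have h1 : ν.real J * r ≤ l₁ - l₂ := by
    refine ge_of_tendsto_of_frequently hlim
      ((hα.and_eventually (eventually_ge_atTop 0)).mono fun t ht => ?_)
    exact (mul_le_mul_of_nonneg_left ht.1.le hm).trans (hlow t ht.2)
  have h2 : l₁ - l₂ ≤ ν.real J * q := by
    refine le_of_tendsto_of_frequently hlim
      ((hβ.and_eventually (eventually_ge_atTop 0)).mono fun t ht => ?_)
    exact (hup t ht.2).trans (mul_le_mul_of_nonneg_left ht.1.le hm)
  have h3 : ν.real J = 0 := by nlinarith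
  exact (measureReal_eq_zero_iff).1 h3

/-- If `s` is a set of reals such that `μ` charges no interval with endpoints in `s`, then
`s` is null. -/
theorem measure_eq_zero_of_Icc_null {μ : Measure ℝ} {s : Set ℝ}
    (h : ∀ a ∈ s, ∀ b ∈ s, a ≤ b → μ (Icc a b) = 0) : μ s = 0 := by
  refine measure_null_of_locally_null s fun a ha => ?_
  have hl : ∃ c < a, μ (s ∩ Icc c a) = 0 := by
    by_cases hc : ∃ c ∈ s, c < a
    · obtain ⟨c, hcs, hca⟩ := hc
      exact ⟨c, hca, measure_mono_null inter_subset_right (h c hcs a ha hca.le)⟩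
    · push Not at hc
      exact ⟨a - 1, by linarith, measure_mono_null
        (fun b hb => mem_Icc.2 ⟨hc b hb.1, hb.2.2⟩) (h a ha a ha le_rfl)⟩
  have hr : ∃ b > a, μ (s ∩ Icc a b) = 0 := by
    by_cases hb : ∃ b ∈ s, a < b
    · obtain ⟨b, hbs, hab⟩ := hb
      exact ⟨b, hab, measure_mono_null inter_subset_right (h a ha b hbs hab.le)⟩
    · push Not at hb
      exact ⟨a + 1, by linarith, measure_mono_null
        (fun c hc => mem_Icc.2 ⟨hc.2.1, hb c hc.1⟩) (h a ha a ha le_rfl)⟩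
  obtain ⟨c, hca, hc⟩ := hl
  obtain ⟨b, hab, hb⟩ := hr
  refine ⟨s ∩ Icc c b, inter_mem_nhdsWithin s (Icc_mem_nhds hca hab), ?_⟩
  rw [← Icc_union_Icc_eq_Icc hca.le hab.le, inter_union_distrib_left]
  exact measure_union_null hc hb

/-- An order-preserving bounded evolution whose averages over upper sets converge has almost
everywhere convergent trajectories. -/
theorem ae_tendsto_of_upperSet_averages (hmeas : ∀ t, Measurable (X t))
    (hbd : ∀ t, 0 ≤ t → ∀ α, X t α ∈ Icc (0 : ℝ) 1)
    (hmono : ∀ α β, X 0 α ≤ X 0 β → ∀ t, 0 ≤ t → X t α ≤ X t β)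
    (hconv : ∀ U : Set ℝ, IsUpperSet U → MeasurableSet U →
      ∃ l, Tendsto (fun t => ∫ α in X 0 ⁻¹' U, X t α ∂ν) atTop (𝓝 l)) :
    ∀ᵐ α ∂ν, ∃ l, Tendsto (fun t => X t α) atTop (𝓝 l) := by
  have hnull : ∀ q r : ℚ, q < r → ∀ᵐ α ∂ν,
      ¬((∃ᶠ t in atTop, X t α < q) ∧ ∃ᶠ t in atTop, (r : ℝ) < X t α) := by
    intro q r hqr
    set P := {α | (∃ᶠ t in atTop, X t α < q) ∧ ∃ᶠ t in atTop, (r : ℝ) < X t α} with hP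
    have hS : ν.map (X 0) (X 0 '' P) = 0 := by
      apply measure_eq_zero_of_Icc_null
      rintro _ ⟨α, hα, rfl⟩ _ ⟨β, hβ, rfl⟩ hαβ
      rw [Measure.map_apply (hmeas 0) measurableSet_Icc]
      exact measure_preimage_Icc_eq_zero_of_oscillation hmeas hbd hmono hconv
        (Rat.cast_lt.2 hqr) hαβ hα.2 hβ.1
    have hpre := (hmeas 0).quasiMeasurePreserving ν |>.preimage_null hS
    have hPnull : ν P = 0 := measure_mono_null (subset_preimage_image (X 0) P) hpre
    exact measure_eq_zero_iff_ae_notMem.1 hPnull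
  have hall : ∀ᵐ α ∂ν, ∀ q r : ℚ, q < r →
      ¬((∃ᶠ t in atTop, X t α < q) ∧ ∃ᶠ t in atTop, (r : ℝ) < X t α) := by
    simp only [ae_all_iff]
    exact hnull
  filter_upwards [hall] with α hα
  refine tendsto_of_no_upcrossings (s := range ((↑) : ℚ → ℝ)) Rat.denseRange_cast ?_ ?_ ?_
  · rintro _ ⟨q, rfl⟩ _ ⟨r, rfl⟩ hqr
    exact hα q r (Rat.cast_lt.1 hqr)
  · exact isBoundedUnder_of_eventually_le (a := 1)
      ((eventually_ge_atTop 0).mono fun t ht => (hbd t ht α).2)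
  · exact isBoundedUnder_of_eventually_ge (a := 0)
      ((eventually_ge_atTop 0).mono fun t ht => (hbd t ht α).1)

end OrderPreserving

/-- A continuum opinion dynamics on a measure space of agents with weights depending on time and
on the two opinions only. -/
structure IsOpinionFlow {Ω : Type*} [MeasurableSpace Ω] (ν : Measure Ω)
    (w : ℝ → ℝ → ℝ → ℝ) (X : ℝ → Ω → ℝ) : Prop where
  measurable : ∀ t, Measurable (X t)
  continuous : ∀ α, Continuous fun t => X t α
  absCont : ∀ α, ∀ T, 0 ≤ T → AbsolutelyContinuousOnInterval (fun t => X t α) 0 T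
  init_mem : ∀ α, X 0 α ∈ Icc (0 : ℝ) 1
  locBdd : ∀ T, 0 ≤ T → ∃ M : ℝ, ∀ α, ∀ t ∈ Icc 0 T, |X t α| ≤ M
  ode : ∀ α, ∀ᵐ t, 0 < t → HasDerivAt (fun s => X s α)
    (∫ β, w t (X t α) (X t β) * (X t β - X t α) ∂ν) t

theorem abs_kernel_le {Ω : Type*} {w : ℝ → ℝ → ℝ → ℝ} {X : ℝ → Ω → ℝ} {W : ℝ}
    (hnonneg : ∀ t, 0 ≤ t → ∀ a b : ℝ, 0 ≤ w t a b)
    (hbdd : ∀ t, 0 ≤ t → ∀ a b : ℝ, w t a b ≤ W)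
    (hmem : ∀ t, 0 ≤ t → ∀ α, X t α ∈ Icc (0 : ℝ) 1) {t : ℝ} (ht : 0 ≤ t) (α β : Ω) :
    |w t (X t α) (X t β) * (X t β - X t α)| ≤ W := by
  rw [abs_mul, abs_of_nonneg (hnonneg t ht _ _)]
  have h1 : |X t β - X t α| ≤ 1 := by
    rw [abs_le]
    constructor <;> linarith [(hmem t ht α).1, (hmem t ht α).2, (hmem t ht β).1, (hmem t ht β).2]
  calc _ ≤ W * 1 := mul_le_mul (hbdd t ht _ _) h1 (abs_nonneg _)
        ((hnonneg t ht 0 0).trans (hbdd t ht 0 0))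
    _ = W := mul_one W

namespace IsOpinionFlow

variable {Ω : Type*} [MeasurableSpace Ω] {ν : Measure Ω}
  {w : ℝ → ℝ → ℝ → ℝ} {X : ℝ → Ω → ℝ} {W L : ℝ}

theorem measurable_kernel (hX : IsOpinionFlow ν w X)
    (hmeas : Measurable fun p : ℝ × ℝ × ℝ => w p.1 p.2.1 p.2.2) :
    Measurable fun p : (ℝ × Ω) × Ω =>
      w p.1.1 (X p.1.1 p.1.2) (X p.1.1 p.2) * (X p.1.1 p.2 - X p.1.1 p.1.2) := by
  have hu : Measurable (Function.uncurry X) :=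
    measurable_uncurry_of_continuous_of_measurable hX.continuous hX.measurable
  have h1 : Measurable fun p : (ℝ × Ω) × Ω => X p.1.1 p.1.2 := hu.comp measurable_fst
  have h2 : Measurable fun p : (ℝ × Ω) × Ω => X p.1.1 p.2 :=
    hu.comp ((measurable_fst.comp measurable_fst).prodMk measurable_snd)
  exact (hmeas.comp ((measurable_fst.comp measurable_fst).prodMk (h1.prodMk h2))).mul (h2.sub h1)

theorem measurable_kernel_section (hX : IsOpinionFlow ν w X)
    (hmeas : Measurable fun p : ℝ × ℝ × ℝ => w p.1 p.2.1 p.2.2) (t : ℝ) (α : Ω) :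
    Measurable fun β => w t (X t α) (X t β) * (X t β - X t α) :=
  (hX.measurable_kernel hmeas).comp (measurable_prodMk_left (x := (t, α)))

variable [IsProbabilityMeasure ν]

theorem mem_Icc (hX : IsOpinionFlow ν w X)
    (hmeas : Measurable fun p : ℝ × ℝ × ℝ => w p.1 p.2.1 p.2.2)
    (hnonneg : ∀ t, 0 ≤ t → ∀ a b : ℝ, 0 ≤ w t a b)
    (hbdd : ∀ t, 0 ≤ t → ∀ a b : ℝ, w t a b ≤ W) {t : ℝ} (ht : 0 ≤ t) (α : Ω) :
    X t α ∈ Icc (0 : ℝ) 1 := by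
  obtain ⟨M, hM⟩ := hX.locBdd t ht
  have hM0 : 0 ≤ M := (abs_nonneg _).trans (hM α 0 ⟨le_rfl, ht⟩)
  have hint : ∀ s ∈ Icc 0 t, ∀ α,
      Integrable (fun β => w s (X s α) (X s β) * (X s β - X s α)) ν := fun s hs α => by
    refine Integrable.of_bound (hX.measurable_kernel_section hmeas s α).aestronglyMeasurable
      (W * (M + M)) (ae_of_all _ fun β => ?_)
    rw [Real.norm_eq_abs, abs_mul, abs_of_nonneg (hnonneg s hs.1 _ _)]
    refine mul_le_mul (hbdd s hs.1 _ _) ((abs_sub _ _).trans (add_le_add (hM β s hs) (hM α s hs)))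
      (abs_nonneg _) ((hnonneg s hs.1 0 0).trans (hbdd s hs.1 0 0))
  have hconst : ∀ c : ℝ, ∫ _ : Ω, c ∂ν = c := fun c => by simp
  constructor
  · have := nonpos_of_deriv_le_bound_sub (y := fun s α => -X s α) (W := W) ht
      (fun α s hs => (hX.absCont α s hs.1).fun_neg)
      (fun α => neg_nonpos.2 (hX.init_mem α).1)
      ⟨M, fun α s hs => (neg_le_abs _).trans (hM α s hs)⟩ ?_ α
    · exact neg_nonpos.1 this
    · intro α
      filter_upwards [hX.ode α] with s hs hmem
      have hsI : s ∈ Icc 0 t := ⟨hmem.1.le, hmem.2⟩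
      refine ⟨_, (hs hmem.1).neg, fun B _ hB => ?_⟩
      rw [← integral_neg, ← hconst (W * (B - -X s α))]
      refine integral_mono (hint s hsI α).neg (integrable_const _) fun β => ?_
      have h1 := hnonneg s hsI.1 (X s α) (X s β)
      have h2 := hbdd s hsI.1 (X s α) (X s β)
      have h3 := hB β
      have h4 := hB α
      simp only
      nlinarith [mul_le_mul_of_nonneg_left (show X s α - X s β ≤ B - -X s α by linarith) h1,
        mul_le_mul_of_nonneg_right h2 (show 0 ≤ B - -X s α by linarith)]
  · have := nonpos_of_deriv_le_bound_sub (y := fun s α => X s α - 1) (W := W) ht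
      (fun α s hs => (hX.absCont α s hs.1).fun_sub
        (ContDiffOn.absolutelyContinuousOnInterval (by fun_prop)))
      (fun α => sub_nonpos.2 (hX.init_mem α).2)
      ⟨M, fun α s hs => by linarith [(le_abs_self _).trans (hM α s hs)]⟩ ?_ α
    · exact sub_nonpos.1 this
    · intro α
      filter_upwards [hX.ode α] with s hs hmem
      have hsI : s ∈ Icc 0 t := ⟨hmem.1.le, hmem.2⟩
      refine ⟨_, (hs hmem.1).sub_const 1, fun B _ hB => ?_⟩
      rw [← hconst (W * (B - (X s α - 1)))]
      refine integral_mono (hint s hsI α) (integrable_const _) fun β => ?_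
      have h1 := hnonneg s hsI.1 (X s α) (X s β)
      have h2 := hbdd s hsI.1 (X s α) (X s β)
      have h3 := hB β
      have h4 := hB α
      simp only
      nlinarith [mul_le_mul_of_nonneg_left (show X s β - X s α ≤ B - (X s α - 1) by linarith) h1,
        mul_le_mul_of_nonneg_right h2 (show 0 ≤ B - (X s α - 1) by linarith)]

theorem integrable_kernel_section (hX : IsOpinionFlow ν w X)
    (hmeas : Measurable fun p : ℝ × ℝ × ℝ => w p.1 p.2.1 p.2.2)
    (hnonneg : ∀ t, 0 ≤ t → ∀ a b : ℝ, 0 ≤ w t a b)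
    (hbdd : ∀ t, 0 ≤ t → ∀ a b : ℝ, w t a b ≤ W)
    (hmem : ∀ t, 0 ≤ t → ∀ α, X t α ∈ Icc (0 : ℝ) 1) {t : ℝ} (ht : 0 ≤ t) (α : Ω) :
    Integrable (fun β => w t (X t α) (X t β) * (X t β - X t α)) ν :=
  Integrable.of_bound (hX.measurable_kernel_section hmeas t α).aestronglyMeasurable W
    (ae_of_all _ fun β => abs_kernel_le hnonneg hbdd hmem ht α β)

theorem order_preserving (hX : IsOpinionFlow ν w X)
    (hmeas : Measurable fun p : ℝ × ℝ × ℝ => w p.1 p.2.1 p.2.2)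
    (hnonneg : ∀ t, 0 ≤ t → ∀ a b : ℝ, 0 ≤ w t a b)
    (hbdd : ∀ t, 0 ≤ t → ∀ a b : ℝ, w t a b ≤ W)
    (hsymm : ∀ t a b : ℝ, w t a b = w t b a)
    (hlip : ∀ t u y z : ℝ, |w t u y - w t u z| ≤ L * |y - z|)
    (hmem : ∀ t, 0 ≤ t → ∀ α, X t α ∈ Icc (0 : ℝ) 1) {α β : Ω} (hαβ : X 0 α ≤ X 0 β)
    {t : ℝ} (ht : 0 ≤ t) : X t α ≤ X t β := by
  refine sub_nonpos.1 (nonpos_of_abs_deriv_le (z := fun s => X s α - X s β) (K := L + W) ht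
    ((hX.absCont α t ht).fun_sub (hX.absCont β t ht)) ?_ (sub_nonpos.2 hαβ))
  filter_upwards [hX.ode α, hX.ode β] with s hα hβ hs
  refine ⟨_, (hα hs.1).sub (hβ hs.1), ?_⟩
  have hs0 : 0 ≤ s := hs.1.le
  rw [← integral_sub (hX.integrable_kernel_section hmeas hnonneg hbdd hmem hs0 α)
    (hX.integrable_kernel_section hmeas hnonneg hbdd hmem hs0 β)]
  have hbound : ∀ γ, ‖w s (X s α) (X s γ) * (X s γ - X s α) -
      w s (X s β) (X s γ) * (X s γ - X s β)‖ ≤ (L + W) * |X s α - X s β| := by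
    intro γ
    have h1 : |X s γ - X s α| ≤ 1 := by
      rw [abs_le]
      constructor <;>
        linarith [(hmem s hs0 α).1, (hmem s hs0 α).2, (hmem s hs0 γ).1, (hmem s hs0 γ).2]
    have h2 : |w s (X s α) (X s γ) - w s (X s β) (X s γ)| ≤ L * |X s α - X s β| := by
      rw [hsymm s (X s α), hsymm s (X s β)]
      exact hlip s _ _ _
    calc _ = |(w s (X s α) (X s γ) - w s (X s β) (X s γ)) * (X s γ - X s α) -
          w s (X s β) (X s γ) * (X s α - X s β)| := by rw [Real.norm_eq_abs]; congr 1; ring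
      _ ≤ |w s (X s α) (X s γ) - w s (X s β) (X s γ)| * |X s γ - X s α| +
          w s (X s β) (X s γ) * |X s α - X s β| := by
        refine (abs_sub _ _).trans ?_
        rw [abs_mul, abs_mul, abs_of_nonneg (hnonneg s hs0 (X s β) (X s γ))]
      _ ≤ L * |X s α - X s β| * 1 + W * |X s α - X s β| := by
        refine add_le_add (mul_le_mul h2 h1 (abs_nonneg _) ((abs_nonneg _).trans h2))
          (mul_le_mul_of_nonneg_right (hbdd s hs0 _ _) (abs_nonneg _))
      _ = _ := by ring
  simpa using norm_integral_le_of_norm_le_const (μ := ν) (ae_of_all _ hbound)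

theorem setIntegral_le_of_upperSet (hX : IsOpinionFlow ν w X)
    (hmeas : Measurable fun p : ℝ × ℝ × ℝ => w p.1 p.2.1 p.2.2)
    (hnonneg : ∀ t, 0 ≤ t → ∀ a b : ℝ, 0 ≤ w t a b)
    (hbdd : ∀ t, 0 ≤ t → ∀ a b : ℝ, w t a b ≤ W)
    (hsymm : ∀ t a b : ℝ, w t a b = w t b a)
    (hmem : ∀ t, 0 ≤ t → ∀ α, X t α ∈ Icc (0 : ℝ) 1)
    (hmono : ∀ α β, X 0 α ≤ X 0 β → ∀ t, 0 ≤ t → X t α ≤ X t β)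
    {U : Set ℝ} (hU : IsUpperSet U) (hUm : MeasurableSet U) {s t : ℝ} (hs : 0 ≤ s)
    (hst : s ≤ t) :
    ∫ α in X 0 ⁻¹' U, X t α ∂ν ≤ ∫ α in X 0 ⁻¹' U, X s α ∂ν := by
  set A := X 0 ⁻¹' U with hA
  have hAm : MeasurableSet A := hX.measurable 0 hUm
  set V : ℝ → Ω → ℝ := fun τ α => ∫ β, w τ (X τ α) (X τ β) * (X τ β - X τ α) ∂ν with hV
  have hVm : StronglyMeasurable (Function.uncurry V) :=
    (hX.measurable_kernel hmeas).stronglyMeasurable.integral_prod_right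
  have hVb : ∀ τ, 0 ≤ τ → ∀ α, ‖V τ α‖ ≤ W := fun τ hτ α => by
    simpa using norm_integral_le_of_norm_le_const (μ := ν)
      (ae_of_all _ fun β => (Real.norm_eq_abs _).trans_le
        (abs_kernel_le hnonneg hbdd hmem hτ α β))
  have hint : ∀ τ, 0 ≤ τ → IntegrableOn (X τ) A ν := fun τ hτ =>
    (Integrable.of_bound (hX.measurable τ).aestronglyMeasurable 1 (ae_of_all _ fun ω => by
      rw [Real.norm_eq_abs, abs_le]
      constructor <;> linarith [(hmem τ hτ ω).1, (hmem τ hτ ω).2])).integrableOn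
  have hftc : ∀ α, X t α - X s α = ∫ τ in s..t, V τ α := fun α => by
    have hac : AbsolutelyContinuousOnInterval (fun τ => X τ α) s t :=
      (hX.absCont α t (hs.trans hst)).mono (by
        rw [uIcc_of_le hst, uIcc_of_le (hs.trans hst)]; exact Icc_subset_Icc_left hs)
    rw [← hac.integral_deriv_eq_sub]
    refine intervalIntegral.integral_congr_ae ?_
    filter_upwards [hX.ode α] with τ hτ hmemτ
    rw [uIoc_of_le hst] at hmemτ
    exact (hτ (hs.trans_lt hmemτ.1)).deriv
  have hVint : Integrable (Function.uncurry V)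
      ((volume.restrict (uIoc s t)).prod (ν.restrict A)) := by
    have : IsFiniteMeasure ((volume : Measure ℝ).restrict (uIoc s t)) :=
      ⟨by simp [uIoc]⟩
    refine Integrable.of_bound hVm.aestronglyMeasurable W ?_
    have : ∀ᵐ p ∂(volume.restrict (uIoc s t)).prod (ν.restrict A), p.1 ∈ uIoc s t :=
      Measure.quasiMeasurePreserving_fst.ae (ae_restrict_mem measurableSet_uIoc)
    filter_upwards [this] with p hp
    rw [uIoc_of_le hst] at hp
    exact hVb p.1 (hs.trans hp.1.le) p.2
  have hflux : ∀ τ, 0 ≤ τ → ∫ α in A, V τ α ∂ν ≤ 0 := fun τ hτ => by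
    refine setIntegral_integral_nonpos_of_antisymm (C := W) ?_
      (abs_kernel_le hnonneg hbdd hmem hτ) (fun α β => ?_) hAm fun α hα β hβ => ?_
    · exact (hX.measurable_kernel hmeas).comp
        ((measurable_prodMk_left.comp measurable_fst).prodMk measurable_snd)
    · rw [hsymm τ (X τ α)]; ring
    · refine mul_nonpos_of_nonneg_of_nonpos (hnonneg τ hτ _ _) (sub_nonpos.2 ?_)
      refine hmono β α (le_of_not_ge fun h => hβ (hU h hα)) τ hτ
  rw [← sub_nonpos, ← integral_sub (hint t (hs.trans hst)) (hint s hs)]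
  simp_rw [hftc]
  rw [← intervalIntegral_integral_swap hVint, intervalIntegral.integral_of_le hst]
  exact setIntegral_nonpos measurableSet_Ioc fun τ hτ => hflux τ (hs.trans hτ.1.le)

theorem ae_tendsto (hX : IsOpinionFlow ν w X)
    (hmeas : Measurable fun p : ℝ × ℝ × ℝ => w p.1 p.2.1 p.2.2)
    (hnonneg : ∀ t, 0 ≤ t → ∀ a b : ℝ, 0 ≤ w t a b)
    (hbdd : ∀ t, 0 ≤ t → ∀ a b : ℝ, w t a b ≤ W)
    (hsymm : ∀ t a b : ℝ, w t a b = w t b a)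
    (hlip : ∀ t u y z : ℝ, |w t u y - w t u z| ≤ L * |y - z|) :
    ∀ᵐ α ∂ν, ∃ l, Tendsto (fun t => X t α) atTop (𝓝 l) := by
  have hmem : ∀ t, 0 ≤ t → ∀ α, X t α ∈ Icc (0 : ℝ) 1 := fun t ht α =>
    hX.mem_Icc hmeas hnonneg hbdd ht α
  have hmono : ∀ α β, X 0 α ≤ X 0 β → ∀ t, 0 ≤ t → X t α ≤ X t β := fun α β h t ht =>
    hX.order_preserving hmeas hnonneg hbdd hsymm hlip hmem h ht
  refine ae_tendsto_of_upperSet_averages hX.measurable hmem hmono fun U hU hUm => ?_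
  have hanti : Antitone fun t => ∫ α in X 0 ⁻¹' U, X (max t 0) α ∂ν := fun s t hst =>
    hX.setIntegral_le_of_upperSet hmeas hnonneg hbdd hsymm hmem hmono hU hUm (le_max_right _ _)
      (max_le_max_right 0 hst)
  have hbelow : BddBelow (range fun t => ∫ α in X 0 ⁻¹' U, X (max t 0) α ∂ν) := by
    refine ⟨0, ?_⟩
    rintro _ ⟨t, rfl⟩
    exact integral_nonneg fun α => (hmem _ (le_max_right _ _) α).1
  refine ⟨_, (tendsto_atTop_ciInf hanti hbelow).congr' ?_⟩
  filter_upwards [eventually_ge_atTop 0] with t ht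
  rw [max_eq_left ht]

end IsOpinionFlow

theorem IsSolution.isOpinionFlow {w : ℝ → ℝ → ℝ → ℝ} {x : ℝ → ℝ → ℝ}
    (hx : IsSolution (fun t _ _ a b => w t a b) x) :
    IsOpinionFlow (volume : Measure (Icc (0 : ℝ) 1)) w fun t α => x (max t 0) α := by
  have hac : ∀ α : Icc (0 : ℝ) 1, ∀ T, 0 ≤ T →
      AbsolutelyContinuousOnInterval (fun t => x t α) 0 T := fun α T hT =>
    (hx.absCont α α.2 T hT).absolutelyContinuousOnInterval hT
  refine ⟨fun t => (hx.meas _ (le_max_right _ _)).comp measurable_subtype_coe, fun α => ?_,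
    fun α T hT => ?_, fun α => ?_, fun T hT => ?_, fun α => ?_⟩
  · have hcont : ContinuousOn (fun t => x t α) (Ici 0) := fun t (ht : 0 ≤ t) => by
      have h := (hac α (t + 1) (by linarith)).continuousOn
      rw [uIcc_of_le (by linarith)] at h
      refine (h t ⟨ht, by linarith⟩).mono_of_mem_nhdsWithin ?_
      filter_upwards [self_mem_nhdsWithin,
        mem_nhdsWithin_of_mem_nhds (Iic_mem_nhds (show t < t + 1 by linarith))] with s h0 h1
      exact ⟨h0, h1⟩
    exact hcont.comp_continuous (by fun_prop) fun t => mem_Ici.2 (le_max_right _ _)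
  · refine AbsolutelyContinuousOn.absolutelyContinuousOnInterval hT fun ε hε => ?_
    obtain ⟨δ, hδ, H⟩ := hx.absCont α α.2 T hT ε hε
    refine ⟨δ, hδ, fun n c d hcd hdisj hlen => ?_⟩
    refine lt_of_eq_of_lt (Finset.sum_congr rfl fun i _ => ?_) (H n c d hcd hdisj hlen)
    rw [max_eq_left (hcd i).1, max_eq_left ((hcd i).1.trans (hcd i).2.1)]
  · simpa using hx.init_mem α α.2
  · obtain ⟨M, hM⟩ := hx.locBdd T hT
    refine ⟨M, fun α t ht => ?_⟩
    simpa [max_eq_left ht.1] using hM α α.2 t ht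
  · have h := hx.ode α α.2
    rw [ae_restrict_iff' measurableSet_Ici] at h
    filter_upwards [h] with t ht ht0
    have h1 := ht (mem_Ici.2 ht0.le)
    have h2 : (fun s => x (max s 0) α) =ᶠ[𝓝 t] fun s => x s α := by
      filter_upwards [Ioi_mem_nhds ht0] with s hs
      rw [max_eq_left (le_of_lt hs)]
    refine (h1.congr_of_eventuallyEq h2).congr_deriv ?_
    rw [interactionField, intervalIntegral.integral_of_le zero_le_one,
      ← integral_Icc_eq_integral_Ioc, max_eq_left ht0.le]
    exact (integral_subtype_comap measurableSet_Icc
      fun β => w t (x t α) (x t β) * (x t β - x t α)).symm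

/-- If the weights depend only on time and the two opinion values via a
nonnegative, bounded, symmetric function `w̃` that is Lipschitz in its last argument,
then for any solution of the opinion dynamics almost every agent's opinion converges. -/
theorem lipschitz_opinion_weights_imply_ae_convergence
    (W L : ℝ) (hW : 0 < W) (wt : ℝ → ℝ → ℝ → ℝ)
    (hmeas : Measurable fun p : ℝ × ℝ × ℝ => wt p.1 p.2.1 p.2.2)
    (hnonneg : ∀ t, 0 ≤ t → ∀ a b : ℝ, 0 ≤ wt t a b)
    (hbdd : ∀ t, 0 ≤ t → ∀ a b : ℝ, wt t a b ≤ W)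
    (hsymm : ∀ t a b : ℝ, wt t a b = wt t b a)
    (hlip : ∀ t u y z : ℝ, |wt t u y - wt t u z| ≤ L * |y - z|)
    (x : ℝ → ℝ → ℝ)
    (hx : IsSolution (fun t _ _ a b => wt t a b) x) :
    ∀ᵐ α ∂(volume.restrict (Icc (0:ℝ) 1)),
      ∃ l : ℝ, Tendsto (fun t => x t α) atTop (𝓝 l) := by
  rw [ae_restrict_iff_subtype measurableSet_Icc]
  filter_upwards [hx.isOpinionFlow.ae_tendsto hmeas hnonneg hbdd hsymm hlip] with α hα
  obtain ⟨l, hl⟩ := hα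
  refine ⟨l, hl.congr' ?_⟩
  filter_upwards [eventually_ge_atTop 0] with t ht
  rw [max_eq_left ht]
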